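/- Let s ≥ 1, let c_1, …, c_s be the roots of the Radau polynomial p_s, and let b ∈ ℝ^s satisfy the order-s quadrature conditions ∑_{j=1}^s b_j c_j^{k−1} = 1/k for k = 1, …, s. Then every weight is strictly positive: b_j > 0 for all j = 1, …, s. -/

import Mathlib

open Polynomial

/-- The Radau polynomial of index `s`:
`p_s(x) = (d/dx)^(s-1) [x^(s-1) (x-1)^s]`. -/
noncomputable def radauPoly (s : ℕ) : Polynomial ℝ :=
  derivative^[s - 1] (X ^ (s - 1) * (X - 1) ^ s)

/-- Repeated integration by parts: the `m`-th derivative of a polynomial vanishing to order `m`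
at `0` and `1` is orthogonal on `[0, 1]` to every polynomial of degree less than `m`. -/
theorem integral_iterate_derivative_mul_eq_zero (m : ℕ) (f g : ℝ[X])
    (h0 : X ^ m ∣ f) (h1 : (X - 1) ^ m ∣ f) (hg : g.degree < m) :
    ∫ x in (0 : ℝ)..1, (derivative^[m] f * g).eval x = 0 := by
  induction m generalizing g with
  | zero =>
    have : g = 0 := by
      rw [← degree_eq_bot]
      exact Nat.WithBot.lt_zero_iff.mp (by simpa using hg)
    simp [this]
  | succ m ih =>
    have hdeg : (derivative g).degree < m := by
      by_cases hz : derivative g = 0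
      · simp [hz]
      · have hg0 : g ≠ 0 := by
          rintro rfl
          simp at hz
        have h2 := degree_derivative_lt hg0
        rw [degree_eq_natDegree hz] at h2 ⊢
        rw [degree_eq_natDegree hg0] at h2 hg
        norm_cast at h2 hg ⊢
        omega
    have hprev := ih (derivative g) ((pow_dvd_pow X m.le_succ).trans h0)
      ((pow_dvd_pow (X - 1) m.le_succ).trans h1) hdeg
    have e0 : (derivative^[m] f).eval 0 = 0 := by
      have := pow_sub_dvd_iterate_derivative_of_pow_dvd m h0
      simpa using eval_eq_zero_of_dvd_of_eval_eq_zero (x := 0) this (by simp)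
    have e1 : (derivative^[m] f).eval 1 = 0 := by
      have := pow_sub_dvd_iterate_derivative_of_pow_dvd m h1
      simpa using eval_eq_zero_of_dvd_of_eval_eq_zero (x := 1) this (by simp)
    have hftc : ∫ x in (0 : ℝ)..1, (derivative (derivative^[m] f * g)).eval x =
        (derivative^[m] f * g).eval 1 - (derivative^[m] f * g).eval 0 :=
      intervalIntegral.integral_eq_sub_of_hasDerivAt
        (fun x _ => (derivative^[m] f * g).hasDerivAt x)
        ((Polynomial.continuous _).intervalIntegrable _ _)
    rw [derivative_mul, ← Function.iterate_succ_apply' derivative] at hftc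
    simp only [eval_add] at hftc
    rw [intervalIntegral.integral_add ((Polynomial.continuous _).intervalIntegrable _ _)
      ((Polynomial.continuous _).intervalIntegrable _ _), hprev] at hftc
    simpa [e0, e1] using hftc

theorem natDegree_radauPoly_le {s : ℕ} (hs : 1 ≤ s) : (radauPoly s).natDegree ≤ s := by
  have h := natDegree_iterate_derivative (X ^ (s - 1) * (X - 1) ^ s : ℝ[X]) (s - 1)
  have h2 : (X ^ (s - 1) * (X - 1) ^ s : ℝ[X]).natDegree ≤ (s - 1) + s := by
    rw [← C_1]
    compute_degree
  unfold radauPoly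
  omega

theorem integral_radauPoly_mul_eq_zero (s : ℕ) (g : ℝ[X]) (hg : g.degree < (s - 1 : ℕ)) :
    ∫ x in (0 : ℝ)..1, (radauPoly s * g).eval x = 0 :=
  integral_iterate_derivative_mul_eq_zero (s - 1) _ g (dvd_mul_right _ _)
    ((pow_dvd_pow _ (Nat.sub_le s 1)).trans (dvd_mul_left _ _)) hg

/-- Quadrature conditions of order `s` integrate exactly all polynomials of degree below `s`. -/
theorem sum_mul_eval_eq_integral_of_natDegree_lt {s : ℕ} {c b : Fin s → ℝ}
    (hb : ∀ k : ℕ, 1 ≤ k → k ≤ s → ∑ j, b j * c j ^ (k - 1) = 1 / (k : ℝ))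
    {r : ℝ[X]} (hr : r.natDegree < s) :
    ∑ j, b j * r.eval (c j) = ∫ x in (0 : ℝ)..1, r.eval x := by
  simp only [eval_eq_sum_range' hr, Finset.mul_sum]
  rw [Finset.sum_comm, intervalIntegral.integral_finsetSum
    (fun i _ => (by fun_prop : Continuous _).intervalIntegrable _ _)]
  refine Finset.sum_congr rfl fun i hi => ?_
  have h := hb (i + 1) (by omega) (Finset.mem_range.mp hi)
  simp only [Nat.add_sub_cancel] at h
  simp only [mul_left_comm (b _), ← Finset.mul_sum, h]
  simp [integral_pow]

/-- The Radau quadrature integrates exactly all polynomials of degree at most `2 * s - 2`. -/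
theorem sum_mul_eval_eq_integral_of_natDegree_le {s : ℕ} (hs : 1 ≤ s) {c b : Fin s → ℝ}
    (hroot : ∀ j, (radauPoly s).IsRoot (c j)) (hdeg : (radauPoly s).natDegree = s)
    (hb : ∀ k : ℕ, 1 ≤ k → k ≤ s → ∑ j, b j * c j ^ (k - 1) = 1 / (k : ℝ))
    {q : ℝ[X]} (hq : q.natDegree ≤ 2 * s - 2) :
    ∑ j, b j * q.eval (c j) = ∫ x in (0 : ℝ)..1, q.eval x := by
  have hp : radauPoly s ≠ 0 := by
    intro h
    rw [h, natDegree_zero] at hdeg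
    omega
  have hdiv : radauPoly s * (q / radauPoly s) + q % radauPoly s = q :=
    EuclideanDomain.div_add_mod q _
  have hr : (q % radauPoly s).natDegree < s := by
    have := natDegree_mod_lt q (q := radauPoly s) (by omega)
    omega
  have hd : (q / radauPoly s).degree < (s - 1 : ℕ) := by
    by_cases hz : q / radauPoly s = 0
    · simp [hz]
    · have h1 := natDegree_mul hp hz
      rw [eq_sub_of_add_eq hdiv] at h1
      have h2 := natDegree_sub_le q (q % radauPoly s)
      rw [degree_eq_natDegree hz]
      norm_cast
      omega
  have hint : ∫ x in (0 : ℝ)..1, q.eval x = ∫ x in (0 : ℝ)..1, (q % radauPoly s).eval x := by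
    conv_lhs => rw [← hdiv]
    simp only [eval_add]
    rw [intervalIntegral.integral_add ((Polynomial.continuous _).intervalIntegrable _ _)
      ((Polynomial.continuous _).intervalIntegrable _ _), integral_radauPoly_mul_eq_zero s _ hd,
      zero_add]
  rw [hint, ← sum_mul_eval_eq_integral_of_natDegree_lt hb hr]
  refine Finset.sum_congr rfl fun j _ => ?_
  conv_lhs => rw [← hdiv]
  simp [(hroot j).eq_zero]

theorem natDegree_radauPoly_of_roots {s : ℕ} (hs : 1 ≤ s) {c : Fin s → ℝ}
    (hc : Function.Injective c) (hroot : ∀ j, (radauPoly s).IsRoot (c j))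
    (hall : ∀ x : ℝ, (radauPoly s).IsRoot x → x ∈ Set.range c) :
    (radauPoly s).natDegree = s := by
  have hp : radauPoly s ≠ 0 := by
    intro h
    have huniv : Set.range c = Set.univ := Set.eq_univ_of_forall fun x => hall x (by simp [h])
    exact Set.infinite_univ (huniv ▸ Set.finite_range c)
  refine le_antisymm (natDegree_radauPoly_le hs) ?_
  have h := card_le_degree_of_subset_roots (p := radauPoly s) (Z := Finset.univ.image c) (by
    intro x hx
    obtain ⟨j, -, rfl⟩ := Finset.mem_image.mp (Finset.mem_val.mp hx)
    exact (mem_roots hp).mpr (hroot j))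
  rwa [Finset.card_image_of_injective _ hc, Finset.card_fin] at h

theorem integral_eval_sq_pos {q : ℝ[X]} (hq : q ≠ 0) :
    0 < ∫ x in (0 : ℝ)..1, (q ^ 2).eval x := by
  obtain ⟨x, hx, hqx⟩ : ∃ x ∈ Set.Icc (0 : ℝ) 1, q.eval x ≠ 0 := by
    by_contra! h
    exact hq (eq_zero_of_infinite_isRoot q ((Set.Icc_infinite zero_lt_one).mono h))
  refine intervalIntegral.integral_pos zero_lt_one (Polynomial.continuous _).continuousOn
    (fun y _ => by simpa using sq_nonneg (q.eval y)) ⟨x, hx, ?_⟩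
  rw [eval_pow]
  positivity

/-- If `c_1, …, c_s` are the pairwise distinct roots of the Radau polynomial
`p_s` and `b` satisfies the order-`s` quadrature conditions
`∑ⱼ bⱼ cⱼ^(k-1) = 1/k` for `k = 1, …, s`, then all weights are strictly
positive. -/
theorem radau_weights_positive (s : ℕ) (hs : 1 ≤ s)
    (c : Fin s → ℝ) (hc : Function.Injective c)
    (hroot : ∀ j, (radauPoly s).IsRoot (c j))
    (hall : ∀ x : ℝ, (radauPoly s).IsRoot x → x ∈ Set.range c)
    (b : Fin s → ℝ)
    (hb : ∀ k : ℕ, 1 ≤ k → k ≤ s → ∑ j, b j * c j ^ (k - 1) = 1 / (k : ℝ)) :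
    ∀ j, 0 < b j := by
  intro j
  set l : ℝ[X] := ∏ i ∈ Finset.univ.erase j, (X - C (c i)) with hl
  have hdeg : (l ^ 2).natDegree ≤ 2 * s - 2 := by
    rw [natDegree_pow, hl, natDegree_prod_of_monic _ _ fun i _ => monic_X_sub_C _]
    simp
    omega
  have hexact := sum_mul_eval_eq_integral_of_natDegree_le hs hroot
    (natDegree_radauPoly_of_roots hs hc hroot hall) hb hdeg
  have hzero : ∀ i ∈ Finset.univ, i ≠ j → b i * (l ^ 2).eval (c i) = 0 := by
    intro i _ hij
    have : l.eval (c i) = 0 := by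
      rw [hl, eval_prod]
      exact Finset.prod_eq_zero (Finset.mem_erase.mpr ⟨hij, Finset.mem_univ i⟩) (by simp)
    simp [this]
  rw [Finset.sum_eq_single j hzero (by simp)] at hexact
  have hpos := integral_eval_sq_pos
    (monic_prod_of_monic (Finset.univ.erase j) _ fun i _ => monic_X_sub_C (c i)).ne_zero
  rw [← hl, ← hexact, eval_pow] at hpos
  exact pos_of_mul_pos_left hpos (sq_nonneg _)
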